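/- Let N ≥ 4 and let W : ℝ^N → ℝ be locally integrable and even (W(−x) = W(x) for a.e. x). Assume that W ∈ M_{r,r}(ℝ^N) for every 1 < r < ∞, and that there exists r̄ > N/4 such that W ∈ M_{p,q}(ℝ^N) for every pair (p,q) with 1 − 1/r̄ < 1/p < 1 and 1/q = 1/p + 1/r̄ − 1. Then W satisfies condition (W_N). -/

import Mathlib

open MeasureTheory Filter Complex SchwartzMap Metric
open scoped ENNReal Topology ComplexConjugate

noncomputable section

/-- Convolution of a real kernel with a complex-valued function. -/
def convW {N : ℕ} (W : (Fin N → ℝ) → ℝ) (f : (Fin N → ℝ) → ℂ) (x : Fin N → ℝ) : ℂ :=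
  ∫ y, (W (x - y) : ℂ) * f y

/-- `W ∈ M_{p,q}(ℝ^N)` with constant `K`: for every Schwartz function `f` the convolution
`W∗f` converges absolutely a.e. and `‖W∗f‖_{L^q} ≤ K ‖f‖_{L^p}`. -/
def MemMwith {N : ℕ} (W : (Fin N → ℝ) → ℝ) (p q : ℝ≥0∞) (K : ℝ) : Prop :=
  ∀ f : SchwartzMap (Fin N → ℝ) ℂ,
    (∀ᵐ x : Fin N → ℝ, Integrable (fun y => (W (x - y) : ℂ) * f y) volume) ∧
    eLpNorm (convW W ⇑f) q volume ≤ ENNReal.ofReal K * eLpNorm (⇑f) p volume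

/-- `W ∈ M_{p,q}(ℝ^N)`. -/
def MemM {N : ℕ} (W : (Fin N → ℝ) → ℝ) (p q : ℝ≥0∞) : Prop :=
  ∃ K : ℝ, 0 ≤ K ∧ MemMwith W p q K

/-- Condition `(W_N)` with a given choice of exponents. -/
def CondWnAt {N : ℕ} (W : (Fin N → ℝ) → ℝ)
    (p₁ p₂ p₃ p₄ q₁ q₂ q₃ q₄ s₁ s₂ : ℝ) : Prop :=
  1 ≤ p₁ ∧ 1 ≤ p₂ ∧ 1 ≤ p₃ ∧ 1 ≤ p₄ ∧ 1 ≤ q₁ ∧ 1 ≤ q₂ ∧ 1 ≤ q₃ ∧ 1 ≤ q₄ ∧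
  1 ≤ s₁ ∧ 1 ≤ s₂ ∧
  (3 ≤ N →
    p₄ < (N : ℝ) / ((N : ℝ) - 2) ∧
    2 ≤ p₂ ∧ p₂ < 2 * (N : ℝ) / ((N : ℝ) - 2) ∧
    2 ≤ p₃ ∧ p₃ < 2 * (N : ℝ) / ((N : ℝ) - 2) ∧
    2 ≤ s₁ ∧ s₁ < 2 * (N : ℝ) / ((N : ℝ) - 2) ∧
    2 ≤ s₂ ∧ s₂ < 2 * (N : ℝ) / ((N : ℝ) - 2) ∧
    2 * (N : ℝ) / ((N : ℝ) + 2) < q₁ ∧ q₁ ≤ 2 ∧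
    (N : ℝ) / 2 < q₃ ∧ (N : ℝ) / 2 < q₄) ∧
  (N ≤ 2 → 2 ≤ p₂ ∧ 2 ≤ p₃ ∧ 2 ≤ s₁ ∧ 2 ≤ s₂ ∧ 1 < q₁ ∧ q₁ ≤ 2) ∧
  MemM W 2 2 ∧
  MemM W (ENNReal.ofReal p₁) (ENNReal.ofReal q₁) ∧
  MemM W (ENNReal.ofReal p₂) (ENNReal.ofReal q₂) ∧
  MemM W (ENNReal.ofReal p₃) (ENNReal.ofReal q₃) ∧
  MemM W (ENNReal.ofReal p₄) (ENNReal.ofReal q₄) ∧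
  1 / p₃ + 1 / q₂ = 1 / q₁ ∧ 1 / p₁ - 1 / p₃ = 1 / s₁ ∧ 1 / q₁ - 1 / q₃ = 1 / s₂

/-- Condition `(W_N)`. -/
def CondWn {N : ℕ} (W : (Fin N → ℝ) → ℝ) : Prop :=
  ∃ p₁ p₂ p₃ p₄ q₁ q₂ q₃ q₄ s₁ s₂ : ℝ, CondWnAt W p₁ p₂ p₃ p₄ q₁ q₂ q₃ q₄ s₁ s₂
lemma convW_smul {N : ℕ} (W : (Fin N → ℝ) → ℝ) (c : ℂ) (f : (Fin N → ℝ) → ℂ) :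
    convW W (c • f) = c • convW W f := by
  funext x
  simp only [convW, Pi.smul_apply, smul_eq_mul, ← integral_const_mul]
  congr 1
  funext y
  ring

lemma aestronglyMeasurable_convW {N : ℕ} {W : (Fin N → ℝ) → ℝ}
    (hW : AEStronglyMeasurable W volume) (f : SchwartzMap (Fin N → ℝ) ℂ) :
    AEStronglyMeasurable (convW W f) volume := by
  have h := AEStronglyMeasurable.convolution_integrand (ContinuousLinearMap.mul ℝ ℂ)
    (μ := (volume : Measure (Fin N → ℝ))) (ν := (volume : Measure (Fin N → ℝ)))
    f.continuous.aestronglyMeasurable (Complex.continuous_ofReal.comp_aestronglyMeasurable hW)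
  refine h.integral_prod_right'.congr (Eventually.of_forall fun x => ?_)
  simp [convW, mul_comm]

lemma lintegral_enorm_rpow_eq_eLpNorm_rpow {α : Type*} [MeasurableSpace α] {μ : Measure α}
    (f : α → ℂ) {r : ℝ} (hr : 0 < r) :
    ∫⁻ x, ‖f x‖ₑ ^ r ∂μ = eLpNorm f (ENNReal.ofReal r) μ ^ r := by
  rw [eLpNorm_eq_lintegral_rpow_enorm_toReal (by simpa using hr) ENNReal.ofReal_ne_top,
    ENNReal.toReal_ofReal hr.le, ← ENNReal.rpow_mul, one_div, inv_mul_cancel₀ hr.ne',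
    ENNReal.rpow_one]

lemma memM_of_forall_eLpNorm_eq_one {N : ℕ} {W : (Fin N → ℝ) → ℝ} {p q : ℝ≥0∞} (hp : p ≠ 0)
    (hint : ∀ f : SchwartzMap (Fin N → ℝ) ℂ,
      ∀ᵐ x : Fin N → ℝ, Integrable (fun y => (W (x - y) : ℂ) * f y) volume)
    {C : ℝ≥0∞} (hC : C ≠ ∞)
    (h : ∀ f : SchwartzMap (Fin N → ℝ) ℂ, eLpNorm f p volume = 1 →
      eLpNorm (convW W f) q volume ≤ C) :
    MemM W p q := by
  refine ⟨C.toReal, ENNReal.toReal_nonneg, fun f => ⟨hint f, ?_⟩⟩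
  rw [ENNReal.ofReal_toReal hC]
  rcases eq_or_ne (eLpNorm f p volume) 0 with h0 | h0
  · have hf := (eLpNorm_eq_zero_iff f.continuous.aestronglyMeasurable hp).1 h0
    have hconv : convW W f = 0 := by
      funext x
      refine integral_eq_zero_of_ae ?_
      filter_upwards [hf] with y hy
      simp [hy]
    simp [hconv]
  have htop : eLpNorm f p volume ≠ ∞ := (f.memLp p volume).eLpNorm_ne_top
  obtain ⟨c, hcn⟩ : ∃ c : ℂ, ‖c‖ₑ = eLpNorm f p volume :=
    ⟨((eLpNorm f p volume).toReal : ℂ), by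
      rw [← ofReal_norm, Complex.norm_real, Real.norm_of_nonneg ENNReal.toReal_nonneg,
        ENNReal.ofReal_toReal htop]⟩
  have hc0 : c ≠ 0 := by
    rw [← enorm_ne_zero, hcn]; exact h0
  obtain ⟨g, hfg⟩ : ∃ g : SchwartzMap (Fin N → ℝ) ℂ,
      (f : (Fin N → ℝ) → ℂ) = c • (g : (Fin N → ℝ) → ℂ) :=
    ⟨c⁻¹ • f, funext fun x => by simp [hc0]⟩
  have hg : eLpNorm g p volume = 1 := by
    have h1 := eLpNorm_const_smul c (g : (Fin N → ℝ) → ℂ) p volume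
    rw [← hfg, hcn] at h1
    exact (ENNReal.mul_eq_left h0 htop).1 h1.symm
  calc eLpNorm (convW W f) q volume
      = ‖c‖ₑ * eLpNorm (convW W g) q volume := by
        rw [← eLpNorm_const_smul, ← convW_smul, ← hfg]
    _ ≤ eLpNorm f p volume * C := by rw [hcn]; gcongr; exact h g hg
    _ = C * eLpNorm f p volume := mul_comm _ _

/-- Interpolation in the target exponent for a fixed source exponent. -/
lemma MemM.interpolate_target {N : ℕ} {W : (Fin N → ℝ) → ℝ}
    (hW : AEStronglyMeasurable W volume) {p : ℝ≥0∞} {q₀ q q₁ : ℝ} (hp : p ≠ 0)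
    (hq₀ : 0 < q₀) (h0 : q₀ ≤ q) (h1 : q ≤ q₁)
    (hM₀ : MemM W p (ENNReal.ofReal q₀)) (hM₁ : MemM W p (ENNReal.ofReal q₁)) :
    MemM W p (ENNReal.ofReal q) := by
  obtain ⟨K₀, -, hK₀⟩ := hM₀
  obtain ⟨K₁, -, hK₁⟩ := hM₁
  have hq : 0 < q := hq₀.trans_le h0
  have hq₁ : 0 < q₁ := hq.trans_le h1
  refine memM_of_forall_eLpNorm_eq_one hp (fun f => (hK₀ f).1)
    (C := (ENNReal.ofReal K₀ ^ q₀ + ENNReal.ofReal K₁ ^ q₁) ^ q⁻¹) ?_ fun f hf => ?_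
  · exact ENNReal.rpow_ne_top_of_nonneg (by positivity) (ENNReal.add_ne_top.2
      ⟨ENNReal.rpow_ne_top_of_nonneg hq₀.le ENNReal.ofReal_ne_top,
        ENNReal.rpow_ne_top_of_nonneg hq₁.le ENNReal.ofReal_ne_top⟩)
  have b0 := (hK₀ f).2
  have b1 := (hK₁ f).2
  rw [hf, mul_one] at b0 b1
  rw [ENNReal.le_rpow_inv_iff hq, ← lintegral_enorm_rpow_eq_eLpNorm_rpow _ hq]
  calc ∫⁻ x, ‖convW W f x‖ₑ ^ q
      ≤ ∫⁻ x, (‖convW W f x‖ₑ ^ q₀ + ‖convW W f x‖ₑ ^ q₁) := by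
        refine lintegral_mono fun x => ?_
        rcases le_total ‖convW W f x‖ₑ 1 with ht | ht
        · exact (ENNReal.rpow_le_rpow_of_exponent_ge ht h0).trans le_self_add
        · exact (ENNReal.rpow_le_rpow_of_exponent_le ht h1).trans le_add_self
    _ = eLpNorm (convW W f) (ENNReal.ofReal q₀) volume ^ q₀
        + eLpNorm (convW W f) (ENNReal.ofReal q₁) volume ^ q₁ := by
        rw [lintegral_add_left' ((aestronglyMeasurable_convW hW f).enorm.pow_const _),
          lintegral_enorm_rpow_eq_eLpNorm_rpow _ hq₀, lintegral_enorm_rpow_eq_eLpNorm_rpow _ hq₁]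
    _ ≤ _ := by gcongr

/-- A Schwartz function splits into a Schwartz part living where it is large and a bounded
Schwartz part. -/
lemma exists_schwartz_truncation {N : ℕ} (f : SchwartzMap (Fin N → ℝ) ℂ) :
    ∃ g h : SchwartzMap (Fin N → ℝ) ℂ, f = g + h ∧
      (∀ x, ‖g x‖ ≤ ‖f x‖) ∧ (∀ x, ‖f x‖ ≤ 1 → g x = 0) ∧
      (∀ x, ‖h x‖ ≤ ‖f x‖) ∧ (∀ x, ‖h x‖ ≤ 2) := by
  let χ : (Fin N → ℝ) → ℝ := fun x => Real.smoothTransition (‖f x‖ ^ 2 - 1)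
  have hχ0 : ∀ x, 0 ≤ χ x := fun x => Real.smoothTransition.nonneg _
  have hχ1 : ∀ x, χ x ≤ 1 := fun x => Real.smoothTransition.le_one _
  have hzero : ∀ x, ‖f x‖ ≤ 1 → χ x = 0 := fun x hx =>
    Real.smoothTransition.zero_of_nonpos (by nlinarith [norm_nonneg (f x)])
  have hone : ∀ x, 2 ≤ ‖f x‖ → χ x = 1 := fun x hx =>
    Real.smoothTransition.one_of_one_le (by nlinarith)
  have hχs : ContDiff ℝ ((⊤ : ℕ∞) : WithTop ℕ∞) χ :=
    Real.smoothTransition.contDiff.comp ((((f.smooth _)).norm_sq ℝ).sub contDiff_const)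
  have hsmooth : ContDiff ℝ ((⊤ : ℕ∞) : WithTop ℕ∞) (fun x => (χ x : ℂ) * f x) :=
    (Complex.ofRealCLM.contDiff.comp hχs).mul (f.smooth _)
  have hsupp : HasCompactSupport (fun x => (χ x : ℂ) * f x) := by
    have hev : ∀ᶠ x in cocompact (Fin N → ℝ), ‖f x‖ < 1 := by
      have := f.tendsto_cocompact.norm
      rw [norm_zero] at this
      exact this.eventually_lt_const one_pos
    obtain ⟨K, hK, hKs⟩ := mem_cocompact.1 hev
    refine HasCompactSupport.intro hK fun x hx => ?_
    simp [hzero x (le_of_lt (hKs hx))]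
  let g := hsupp.toSchwartzMap hsmooth
  have hg : ∀ x, g x = (χ x : ℂ) * f x := fun x => rfl
  have hh : ∀ x, (f - g) x = ((1 - χ x : ℝ) : ℂ) * f x := fun x => by
    rw [sub_apply, hg]; push_cast; ring
  have hhn : ∀ x, ‖(f - g) x‖ = (1 - χ x) * ‖f x‖ := fun x => by
    rw [hh, norm_mul, Complex.norm_real, Real.norm_of_nonneg (by linarith [hχ1 x])]
  refine ⟨g, f - g, by abel, fun x => ?_, fun x hx => by simp [hg, hzero x hx], fun x => ?_,
    fun x => ?_⟩
  · rw [hg, norm_mul, Complex.norm_real, Real.norm_of_nonneg (hχ0 x)]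
    exact mul_le_of_le_one_left (norm_nonneg _) (hχ1 x)
  · rw [hhn]
    exact mul_le_of_le_one_left (norm_nonneg _) (by linarith [hχ0 x])
  · rw [hhn]
    rcases le_total 2 ‖f x‖ with h2 | h2
    · simp [hone x h2]
    · nlinarith [mul_nonneg (hχ0 x) (norm_nonneg (f x))]

/-- Interpolation in the source exponent for a fixed target exponent. -/
lemma MemM.interpolate_source {N : ℕ} {W : (Fin N → ℝ) → ℝ}
    (hW : AEStronglyMeasurable W volume) {q : ℝ≥0∞} {p₀ p p₁ : ℝ} (hq : 1 ≤ q)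
    (hp₀ : 0 < p₀) (h0 : p₀ ≤ p) (h1 : p ≤ p₁)
    (hM₀ : MemM W (ENNReal.ofReal p₀) q) (hM₁ : MemM W (ENNReal.ofReal p₁) q) :
    MemM W (ENNReal.ofReal p) q := by
  obtain ⟨K₀, -, hK₀⟩ := hM₀
  obtain ⟨K₁, -, hK₁⟩ := hM₁
  have hp : 0 < p := hp₀.trans_le h0
  have hp₁ : 0 < p₁ := hp.trans_le h1
  refine memM_of_forall_eLpNorm_eq_one (by simpa using hp) (fun f => (hK₀ f).1)
    (C := ENNReal.ofReal K₀ * 1 + ENNReal.ofReal K₁ * ((2 : ℝ≥0∞) ^ (p₁ - p)) ^ p₁⁻¹)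
    ?_ fun f hf => ?_
  · refine ENNReal.add_ne_top.2 ⟨by simp, ENNReal.mul_ne_top ENNReal.ofReal_ne_top ?_⟩
    exact ENNReal.rpow_ne_top_of_nonneg (by positivity)
      (ENNReal.rpow_ne_top_of_nonneg (by linarith) ENNReal.ofNat_ne_top)
  obtain ⟨g, h, rfl, hgf, hg0, hhf, hh2⟩ := exists_schwartz_truncation f
  set f := g + h with hfdef
  have hfp : ∫⁻ x, ‖f x‖ₑ ^ p = 1 := by
    rw [lintegral_enorm_rpow_eq_eLpNorm_rpow _ hp, hf, ENNReal.one_rpow]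
  have hg : eLpNorm g (ENNReal.ofReal p₀) volume ≤ 1 := by
    rw [← ENNReal.one_rpow p₀⁻¹, ENNReal.le_rpow_inv_iff hp₀,
      ← lintegral_enorm_rpow_eq_eLpNorm_rpow _ hp₀, ← hfp]
    refine lintegral_mono fun x => ?_
    rcases le_total ‖f x‖ 1 with hx | hx
    · simp [hg0 x hx, hp₀]
    · calc ‖g x‖ₑ ^ p₀ ≤ ‖f x‖ₑ ^ p₀ := by
            gcongr; exact enorm_le_iff_norm_le.2 (hgf x)
        _ ≤ ‖f x‖ₑ ^ p := ENNReal.rpow_le_rpow_of_exponent_le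
            (by simpa [← ofReal_norm] using hx) h0
  have hh : eLpNorm h (ENNReal.ofReal p₁) volume ≤ ((2 : ℝ≥0∞) ^ (p₁ - p)) ^ p₁⁻¹ := by
    rw [ENNReal.le_rpow_inv_iff hp₁, ← lintegral_enorm_rpow_eq_eLpNorm_rpow _ hp₁]
    calc ∫⁻ x, ‖h x‖ₑ ^ p₁ ≤ ∫⁻ x, (2 : ℝ≥0∞) ^ (p₁ - p) * ‖f x‖ₑ ^ p := by
          refine lintegral_mono fun x => ?_
          calc ‖h x‖ₑ ^ p₁ = ‖h x‖ₑ ^ (p₁ - p) * ‖h x‖ₑ ^ p := by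
                rw [← ENNReal.rpow_add_of_nonneg _ _ (by linarith) hp.le, sub_add_cancel]
            _ ≤ _ := by
                gcongr
                · simpa using ENNReal.ofReal_le_ofReal (hh2 x)
                · exact enorm_le_iff_norm_le.2 (hhf x)
      _ = (2 : ℝ≥0∞) ^ (p₁ - p) := by
          rw [lintegral_const_mul' _ _
            (ENNReal.rpow_ne_top_of_nonneg (by linarith) ENNReal.ofNat_ne_top), hfp, mul_one]
  have hadd : convW W f =ᵐ[volume] convW W g + convW W h := by
    filter_upwards [(hK₀ g).1, (hK₀ h).1] with x hx1 hx2
    simp only [convW, Pi.add_apply]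
    rw [← integral_add hx1 hx2]
    simp [hfdef, mul_add]
  calc eLpNorm (convW W f) q volume
      = eLpNorm (convW W g + convW W h) q volume := eLpNorm_congr_ae hadd
    _ ≤ eLpNorm (convW W g) q volume + eLpNorm (convW W h) q volume :=
        eLpNorm_add_le (aestronglyMeasurable_convW hW g) (aestronglyMeasurable_convW hW h) hq
    _ ≤ _ := by
        refine add_le_add ((hK₀ g).2.trans ?_) ((hK₁ h).2.trans ?_) <;> gcongr

/-- If `W` belongs to `M_{r,r}` for all `1 < r < ∞` and to the whole segment `a - b = d`
of the exponent square (`a = 1/p`, `b = 1/q`), then it belongs to the strip in between. -/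
lemma memM_strip {N : ℕ} {W : (Fin N → ℝ) → ℝ} (hW : AEStronglyMeasurable W volume) {d : ℝ}
    (hd1 : d < 1)
    (hdiag : ∀ r : ℝ, 1 < r → MemM W (ENNReal.ofReal r) (ENNReal.ofReal r))
    (hoff : ∀ a : ℝ, d < a → a < 1 → MemM W (ENNReal.ofReal a⁻¹) (ENNReal.ofReal (a - d)⁻¹))
    {a b : ℝ} (hb : 0 < b) (hba : b ≤ a) (ha : a < 1) (hab : a - b ≤ d) :
    MemM W (ENNReal.ofReal a⁻¹) (ENNReal.ofReal b⁻¹) := by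
  have hbb : MemM W (ENNReal.ofReal b⁻¹) (ENNReal.ofReal b⁻¹) :=
    hdiag _ ((one_lt_inv₀ hb).2 (hba.trans_lt ha))
  obtain ⟨a', haa', ha'1, hM⟩ : ∃ a', a ≤ a' ∧ a' < 1 ∧
      MemM W (ENNReal.ofReal a'⁻¹) (ENNReal.ofReal b⁻¹) := by
    rcases lt_or_ge (b + d) 1 with h | h
    · refine ⟨b + d, by linarith, h, ?_⟩
      simpa using hoff (b + d) (by linarith) h
    · obtain ⟨a', h1, h2⟩ := exists_between (max_lt ha hd1)
      have haa' : a < a' := (le_max_left _ _).trans_lt h1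
      have hda' : d < a' := (le_max_right _ _).trans_lt h1
      have ha' : 0 < a' := by linarith
      refine ⟨a', haa'.le, h2, ?_⟩
      exact MemM.interpolate_target hW (by simpa using ha') (inv_pos.2 ha')
        (inv_anti₀ hb (by linarith)) (inv_anti₀ (by linarith) (by linarith))
        (hdiag _ ((one_lt_inv₀ ha').2 h2)) (hoff a' hda' h2)
  refine MemM.interpolate_source hW ?_ (inv_pos.2 (by linarith)) (inv_anti₀ (by linarith) haa')
    (inv_anti₀ hb hba) hM hbb
  rw [ENNReal.one_le_ofReal]
  exact (one_le_inv₀ hb).2 (by linarith)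

/-- Let `N ≥ 4` and let `W` be locally integrable and even.  If
`W ∈ M_{r,r}(ℝ^N)` for every `1 < r < ∞`, and there is `r̄ > N/4` such that
`W ∈ M_{p,q}(ℝ^N)` for every pair `(p,q)` with `1 - 1/r̄ < 1/p < 1` and
`1/q = 1/p + 1/r̄ - 1`, then `W` satisfies condition `(W_N)`. -/
theorem statement2 {N : ℕ} (hN : 4 ≤ N)
    (W : (Fin N → ℝ) → ℝ) (hWloc : MeasureTheory.LocallyIntegrable W volume)
    (hWeven : ∀ᵐ x : Fin N → ℝ, W (-x) = W x)
    (hdiag : ∀ r : ℝ, 1 < r → MemM W (ENNReal.ofReal r) (ENNReal.ofReal r))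
    (hoff : ∃ rb : ℝ, (N : ℝ) / 4 < rb ∧
      ∀ p q : ℝ, 1 - 1 / rb < 1 / p → 1 / p < 1 → 1 / q = 1 / p + 1 / rb - 1 →
        MemM W (ENNReal.ofReal p) (ENNReal.ofReal q)) :
    CondWn W := by
  obtain ⟨rb, hrb, hoff⟩ := hoff
  have hN4 : (4 : ℝ) ≤ N := by exact_mod_cast hN
  have hN0 : (0 : ℝ) < N := by linarith
  have hrb1 : 1 < rb := by linarith
  have hd1 : 1 - 1 / rb < 1 := by
    have : 0 < 1 / rb := by positivity
    linarith
  have hstrip : ∀ {a b : ℝ}, 0 < b → b ≤ a → a < 1 → a - b ≤ 1 - 1 / rb →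
      MemM W (ENNReal.ofReal a⁻¹) (ENNReal.ofReal b⁻¹) := fun hb hba ha hab =>
    memM_strip hWloc.aestronglyMeasurable hd1 hdiag
      (fun a h1 h2 => hoff _ _ (by simpa using h1) (by simpa using h2)
        (by rw [one_div, inv_inv, one_div a⁻¹, inv_inv]; ring)) hb hba ha hab
  set u : ℝ := 1 / N with hu
  have hu0 : 0 < u := by positivity
  have hu4 : u ≤ 1 / 4 := one_div_le_one_div_of_le (by norm_num) hN4
  set v : ℝ := 1 / rb with hv
  have hv0 : 0 < v := by positivity
  have hvu : v < 4 * u := by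
    rw [hv, hu, mul_one_div, div_lt_div_iff₀ (by linarith) hN0]
    linarith
  have hNu : (N : ℝ) = u⁻¹ := by rw [hu, one_div, inv_inv]
  have e1 : (N : ℝ) / (N - 2) = (1 - 2 * u)⁻¹ := by
    rw [← one_div, div_eq_div_iff (by linarith) (by linarith), hu]
    field_simp
  have e2 : 2 * (N : ℝ) / (N - 2) = (1 / 2 - u)⁻¹ := by
    rw [mul_div_assoc, e1, show (1 / 2 - u) = (1 - 2 * u) / 2 by ring, inv_div]; rfl
  have e3 : 2 * (N : ℝ) / (N + 2) = (1 / 2 + u)⁻¹ := by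
    rw [hu, ← one_div, div_eq_div_iff (by linarith) (by positivity)]
    field_simp
  have e4 : (N : ℝ) / 2 = (2 * u)⁻¹ := by rw [hNu, mul_inv]; ring
  -- The exponents satisfy `1/p₁ = 1/p₄ = a`, `1/p₂ = 1/p₃ = 1/s₁ = 1/s₂ = a/2`,
  -- `1/q₁ = 1/2`, `1/q₂ = 1/q₃ = 1/2 - a/2`, `1/q₄ = 1 - a`.
  obtain ⟨a, ha⟩ : ∃ a : ℝ, a = 1 - v / 2 := ⟨_, rfl⟩
  have hM3 := hstrip (a := a / 2) (b := 1 / 2 - a / 2)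
    (by linarith) (by linarith) (by linarith) (by linarith)
  have one_le : ∀ {t : ℝ}, 0 < t → t ≤ 1 → 1 ≤ t⁻¹ := fun h h' => (one_le_inv₀ h).2 h'
  have two_le : ∀ {t : ℝ}, 0 < t → t ≤ 1 / 2 → 2 ≤ t⁻¹ := fun h h' =>
    (le_inv_comm₀ two_pos h).2 (by linarith)
  have anti : ∀ {s t : ℝ}, 0 < s → s < t → t⁻¹ < s⁻¹ := fun h h' => inv_strictAnti₀ h h'
  refine ⟨a⁻¹, (a / 2)⁻¹, (a / 2)⁻¹, a⁻¹, (1 / 2 : ℝ)⁻¹, (1 / 2 - a / 2)⁻¹, (1 / 2 - a / 2)⁻¹,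
    (1 - a)⁻¹, (a / 2)⁻¹, (a / 2)⁻¹, ?_⟩
  unfold CondWnAt
  rw [e1, e2, e3, e4]
  simp only [one_div (_⁻¹), inv_inv]
  have h1 : 1 ≤ a⁻¹ := one_le (by linarith) (by linarith)
  have h2 : 2 ≤ (a / 2)⁻¹ := two_le (by linarith) (by linarith)
  have h3 : 1 ≤ (1 / 2 - a / 2)⁻¹ := one_le (by linarith) (by linarith)
  have h4 : (a / 2)⁻¹ < (1 / 2 - u)⁻¹ := anti (by linarith) (by linarith)
  have h5 : 1 ≤ (a / 2)⁻¹ := by linarith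
  refine ⟨h1, h5, h5, h1, by norm_num, h3, h3, one_le (by linarith) (by linarith), h5, h5,
    fun _ => ⟨anti (by linarith) (by linarith), h2, h4, h2, h4, h2, h4, h2, h4,
      anti (by norm_num) (by linarith), by norm_num, anti (by linarith) (by linarith),
      anti (by linarith) (by linarith)⟩, fun h => by omega, ?_,
    hstrip (by norm_num) (by linarith) (by linarith) (by linarith), hM3, hM3,
    hstrip (by linarith) (by linarith) (by linarith) (by linarith),
    by ring, by ring, by ring⟩
  simpa using hdiag 2 (by norm_num)
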